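/- Two B₃-valued simple braid monodromy factorizations are strongly (respectively weakly) Hurwitz equivalent if and only if their images under the projection B₃ → PSL(2,ℤ) (sending σ₁ ↦ XY, σ₂ ↦ X²YX⁻¹) are strongly (respectively weakly) Hurwitz equivalent; moreover this projection establishes a bijection between simple B₃-valued and simple PSL(2,ℤ)-valued factorizations of each length r. -/

import Mathlib

/-- `SL(2,ℤ)`. -/
abbrev SL2Z := Matrix.SpecialLinearGroup (Fin 2) ℤ

/-- The matrix `X = [[-1,1],[-1,0]]`, of order 3 in `PSL(2,ℤ)`. -/
def Xm : SL2Z := ⟨!![(-1 : ℤ), 1; -1, 0], by norm_num [Matrix.det_fin_two_of]⟩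

/-- The matrix `Y = [[0,-1],[1,0]]`, of order 2 in `PSL(2,ℤ)`. -/
def Ym : SL2Z := ⟨!![(0 : ℤ), -1; 1, 0], by norm_num [Matrix.det_fin_two_of]⟩

/-- The modular group `PSL(2,ℤ) = SL(2,ℤ)/{±1}`. -/
abbrev PSL2Z := SL2Z ⧸ Subgroup.center SL2Z

/-- The image of `X` in `PSL(2,ℤ)`. -/
def Xb : PSL2Z := QuotientGroup.mk Xm

/-- The image of `Y` in `PSL(2,ℤ)`. -/
def Yb : PSL2Z := QuotientGroup.mk Ym

/-- The braid relation `σ₁σ₂σ₁ = σ₂σ₁σ₂` as a relator in the free group on two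
generators. -/
def braidRel : Set (FreeGroup (Fin 2)) :=
  {FreeGroup.of 0 * FreeGroup.of 1 * FreeGroup.of 0 *
    (FreeGroup.of 1 * FreeGroup.of 0 * FreeGroup.of 1)⁻¹}

/-- The braid group `B₃ = ⟨σ₁,σ₂ | σ₁σ₂σ₁ = σ₂σ₁σ₂⟩`. -/
abbrev B3 := PresentedGroup braidRel

/-- The standard generator `σ₁` of `B₃`. -/
def σ₁ : B3 := PresentedGroup.of 0

/-- The standard generator `σ₂` of `B₃`. -/
def σ₂ : B3 := PresentedGroup.of 1

/-- A single Hurwitz move on a braid monodromy factorization, recorded as a list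
`(m₁, …, m_r)` of elements of `G`: `(…, m_i, m_{i+1}, …) ↦ (…, m_i⁻¹ m_{i+1} m_i, m_i, …)`. -/
inductive HurwitzMove {G : Type*} [Group G] : List G → List G → Prop
  | mk (l₁ l₂ : List G) (a b : G) :
      HurwitzMove (l₁ ++ a :: b :: l₂) (l₁ ++ (a⁻¹ * b * a) :: a :: l₂)

/-- Strong Hurwitz equivalence: the equivalence relation generated by Hurwitz moves
and their inverses. -/
def StrongEq {G : Type*} [Group G] : List G → List G → Prop :=
  Relation.EqvGen HurwitzMove

/-- Weak Hurwitz equivalence: additionally allows global conjugation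
`(m_i) ↦ (g⁻¹ m_i g)`. -/
def WeakEq {G : Type*} [Group G] : List G → List G → Prop :=
  Relation.EqvGen fun x y =>
    HurwitzMove x y ∨ ∃ g : G, y = x.map fun m => g⁻¹ * m * g

/-- A `B₃`-valued factorization is simple if every entry is conjugate to `σ₁`. -/
def SimpleB3 (l : List B3) : Prop := ∀ m ∈ l, IsConj σ₁ m

/-- A `PSL(2,ℤ)`-valued factorization is simple if every entry is conjugate to `XY`. -/
def SimplePSL (l : List PSL2Z) : Prop := ∀ m ∈ l, IsConj (Xb * Yb) m

/-! ### Transporting generated equivalence relations -/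

/-- If `f` maps `S` injectively, respects two relations, and related pairs in the target lift to
related pairs in `S` along either end, then `f` preserves and reflects the generated equivalence
relations on `S`. -/
theorem eqvGen_map_iff {α β : Type*} {f : α → β} {S : Set α} (hf : Set.InjOn f S)
    {r : α → α → Prop} {r' : β → β → Prop}
    (hr : ∀ x y, r x y → r' (f x) (f y))
    (hfwd : ∀ x ∈ S, ∀ b, r' (f x) b → ∃ y ∈ S, f y = b ∧ r x y)
    (hbwd : ∀ y ∈ S, ∀ a, r' a (f y) → ∃ x ∈ S, f x = a ∧ r x y)
    {x y : α} (hx : x ∈ S) (hy : y ∈ S) :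
    Relation.EqvGen r x y ↔ Relation.EqvGen r' (f x) (f y) := by
  constructor
  · intro h
    clear hx hy
    induction h with
    | rel x y h => exact .rel _ _ (hr x y h)
    | refl x => exact .refl _
    | symm x y _ ih => exact .symm _ _ ih
    | trans x y z _ _ ih₁ ih₂ => exact .trans _ _ _ ih₁ ih₂
  · suffices key : ∀ a b, Relation.EqvGen r' a b →
        (∀ x ∈ S, f x = a → ∃ y ∈ S, f y = b ∧ Relation.EqvGen r x y) ∧
        (∀ y ∈ S, f y = b → ∃ x ∈ S, f x = a ∧ Relation.EqvGen r x y) by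
      intro h
      obtain ⟨z, hz, hzy, hxz⟩ := (key _ _ h).1 x hx rfl
      rwa [← hf hz hy hzy]
    intro a b h
    induction h with
    | rel a b h =>
      constructor
      · rintro x hx rfl
        obtain ⟨y, hy, hyb, hxy⟩ := hfwd x hx b h
        exact ⟨y, hy, hyb, .rel _ _ hxy⟩
      · rintro y hy rfl
        obtain ⟨x, hx, hxa, hxy⟩ := hbwd y hy a h
        exact ⟨x, hx, hxa, .rel _ _ hxy⟩
    | refl a => exact ⟨fun x hx h => ⟨x, hx, h, .refl _⟩, fun x hx h => ⟨x, hx, h, .refl _⟩⟩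
    | symm a b _ ih =>
      constructor
      · intro x hx h
        obtain ⟨y, hy, h', e⟩ := ih.2 x hx h
        exact ⟨y, hy, h', .symm _ _ e⟩
      · intro x hx h
        obtain ⟨y, hy, h', e⟩ := ih.1 x hx h
        exact ⟨y, hy, h', .symm _ _ e⟩
    | trans a b c _ _ ih₁ ih₂ =>
      constructor
      · intro x hx h
        obtain ⟨y, hy, h', e⟩ := ih₁.1 x hx h
        obtain ⟨z, hz, h'', e'⟩ := ih₂.1 y hy h'
        exact ⟨z, hz, h'', .trans _ _ _ e e'⟩
      · intro z hz h
        obtain ⟨y, hy, h', e⟩ := ih₂.2 z hz h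
        obtain ⟨x, hx, h'', e'⟩ := ih₁.2 y hy h'
        exact ⟨x, hx, h'', .trans _ _ _ e' e⟩

/-! ### Hurwitz moves and conjugacy classes -/

section Hurwitz

variable {G H : Type*} [Group G] [Group H]

theorem isConj_conj_iff {s m : G} (g : G) : IsConj s (g⁻¹ * m * g) ↔ IsConj s m := by
  have h : IsConj m (g⁻¹ * m * g) := isConj_iff.2 ⟨g⁻¹, by group⟩
  exact ⟨fun h' => h'.trans h.symm, fun h' => h'.trans h⟩

theorem HurwitzMove.map (φ : G →* H) {x y : List G} (h : HurwitzMove x y) :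
    HurwitzMove (x.map φ) (y.map φ) := by
  obtain ⟨l₁, l₂, a, b⟩ := h
  simpa using HurwitzMove.mk (l₁.map φ) (l₂.map φ) (φ a) (φ b)

theorem HurwitzMove.exists_lift_right (φ : G →* H) (s : G) {x : List G} {w : List H}
    (hx : ∀ m ∈ x, IsConj s m) (h : HurwitzMove (x.map φ) w) :
    ∃ y : List G, (∀ m ∈ y, IsConj s m) ∧ y.map φ = w ∧ HurwitzMove x y := by
  generalize hv : x.map φ = v at h
  obtain ⟨l₁, l₂, a, b⟩ := h
  obtain ⟨L₁, L, rfl, rfl, hL⟩ := List.map_eq_append_iff.1 hv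
  obtain ⟨c, L, rfl, rfl, hL'⟩ := List.map_eq_cons_iff.1 hL
  obtain ⟨d, L₂, rfl, rfl, rfl⟩ := List.map_eq_cons_iff.1 hL'
  refine ⟨L₁ ++ (c⁻¹ * d * c) :: c :: L₂, ?_, by simp, .mk _ _ _ _⟩
  simp only [List.mem_append, List.mem_cons] at hx ⊢
  rintro m (hm | rfl | rfl | hm)
  · exact hx m (by tauto)
  · exact (isConj_conj_iff c).2 (hx d (by tauto))
  · exact hx m (by tauto)
  · exact hx m (by tauto)

theorem HurwitzMove.exists_lift_left (φ : G →* H) (s : G) {y : List G} {w : List H}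
    (hy : ∀ m ∈ y, IsConj s m) (h : HurwitzMove w (y.map φ)) :
    ∃ x : List G, (∀ m ∈ x, IsConj s m) ∧ x.map φ = w ∧ HurwitzMove x y := by
  generalize hv : y.map φ = v at h
  obtain ⟨l₁, l₂, a, b⟩ := h
  obtain ⟨L₁, L, rfl, rfl, hL⟩ := List.map_eq_append_iff.1 hv
  obtain ⟨c, L, rfl, hc, hL⟩ := List.map_eq_cons_iff.1 hL
  obtain ⟨d, L₂, rfl, rfl, rfl⟩ := List.map_eq_cons_iff.1 hL
  have hcd : d⁻¹ * (d * c * d⁻¹) * d = c := by group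
  refine ⟨L₁ ++ d :: (d * c * d⁻¹) :: L₂, ?_, ?_, ?_⟩
  · simp only [List.mem_append, List.mem_cons] at hy ⊢
    rintro m (hm | rfl | rfl | hm)
    · exact hy m (by tauto)
    · exact hy m (by tauto)
    · exact (isConj_conj_iff d).1 (by rw [hcd]; exact hy c (by tauto))
    · exact hy m (by tauto)
  · have : φ (d * c * d⁻¹) = b := by simp only [map_mul, map_inv, hc]; group
    simp [← this]
  · simpa only [hcd] using HurwitzMove.mk L₁ L₂ d (d * c * d⁻¹)

theorem List.map_injOn_forall {α β : Type*} {f : α → β} {s : Set α} (hf : Set.InjOn f s) :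
    Set.InjOn (List.map f) {l | ∀ m ∈ l, m ∈ s} := by
  intro l
  induction l with
  | nil => intro _ l' _ h; simpa [eq_comm] using h
  | cons a l ih =>
    intro hl l' hl' h
    cases l' with
    | nil => simp at h
    | cons b l' =>
      simp only [Set.mem_ofPred_eq, List.forall_mem_cons] at hl hl'
      rw [List.map_cons, List.map_cons, List.cons.injEq] at h
      rw [hf hl.1 hl'.1 h.1, ih hl.2 hl'.2 h.2]

variable {φ : G →* H} {s : G}

theorem strongEq_map_iff (hinj : Set.InjOn φ {m | IsConj s m}) {l₁ l₂ : List G}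
    (h₁ : ∀ m ∈ l₁, IsConj s m) (h₂ : ∀ m ∈ l₂, IsConj s m) :
    StrongEq l₁ l₂ ↔ StrongEq (l₁.map φ) (l₂.map φ) :=
  eqvGen_map_iff (List.map_injOn_forall hinj) (fun _ _ h => h.map φ)
    (fun _ hx _ h => h.exists_lift_right φ s hx) (fun _ hy _ h => h.exists_lift_left φ s hy) h₁ h₂

theorem weakEq_map_iff (hinj : Set.InjOn φ {m | IsConj s m}) (hsurj : Function.Surjective φ)
    {l₁ l₂ : List G} (h₁ : ∀ m ∈ l₁, IsConj s m) (h₂ : ∀ m ∈ l₂, IsConj s m) :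
    WeakEq l₁ l₂ ↔ WeakEq (l₁.map φ) (l₂.map φ) := by
  refine eqvGen_map_iff (List.map_injOn_forall hinj) ?_ ?_ ?_ h₁ h₂
  · rintro x y (h | ⟨g, rfl⟩)
    · exact .inl (h.map φ)
    · exact .inr ⟨φ g, by simp⟩
  · rintro x hx w (h | ⟨g, rfl⟩)
    · obtain ⟨y, hy, hyw, hxy⟩ := h.exists_lift_right φ s hx
      exact ⟨y, hy, hyw, .inl hxy⟩
    · obtain ⟨g, rfl⟩ := hsurj g
      refine ⟨x.map fun m => g⁻¹ * m * g, ?_, by simp, .inr ⟨g, rfl⟩⟩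
      intro m hm
      obtain ⟨n, hn, rfl⟩ := List.mem_map.1 hm
      exact (isConj_conj_iff g).2 (hx n hn)
  · rintro y hy w (h | ⟨g, hg⟩)
    · obtain ⟨x, hx, hxw, hxy⟩ := h.exists_lift_left φ s hy
      exact ⟨x, hx, hxw, .inl hxy⟩
    · obtain ⟨g, rfl⟩ := hsurj g
      refine ⟨y.map fun m => g * m * g⁻¹, ?_, ?_, .inr ⟨g, ?_⟩⟩
      · intro m hm
        obtain ⟨n, hn, rfl⟩ := List.mem_map.1 hm
        exact (isConj_conj_iff g).1 (by simpa [mul_assoc] using hy n hn)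
      · have : (y.map φ).map (fun m => φ g * m * (φ g)⁻¹) = w := by
          rw [hg, List.map_map]
          convert List.map_id w using 2
          ext m
          simp [mul_assoc]
        rw [← this]
        simp
      · rw [List.map_map]
        convert (List.map_id y).symm using 2
        ext m
        simp [mul_assoc]

theorem exists_isConj_lift (hsurj : Function.Surjective φ) {w : List H}
    (hw : ∀ m ∈ w, IsConj (φ s) m) : ∃ l : List G, (∀ m ∈ l, IsConj s m) ∧ l.map φ = w := by
  induction w with
  | nil => exact ⟨[], by simp, rfl⟩
  | cons m w ih =>
    rw [List.forall_mem_cons] at hw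
    obtain ⟨l, hl, rfl⟩ := ih hw.2
    obtain ⟨g, hg⟩ := isConj_iff.1 hw.1
    obtain ⟨g, rfl⟩ := hsurj g
    refine ⟨(g * s * g⁻¹) :: l, List.forall_mem_cons.2 ⟨isConj_iff.2 ⟨g, rfl⟩, hl⟩, ?_⟩
    simp [← hg]

end Hurwitz

/-! ### The modular group -/

theorem PSL2Z.mk_eq_mk_iff (A B : SL2Z) :
    (QuotientGroup.mk A : PSL2Z) = QuotientGroup.mk B ↔ B = A ∨ B = -A := by
  rw [QuotientGroup.eq, Matrix.SpecialLinearGroup.mem_center_iff]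
  constructor
  · rintro ⟨r, hr, h⟩
    have hr' : r = 1 ∨ r = -1 := by simpa using hr
    rcases hr' with rfl | rfl
    · left
      have : A⁻¹ * B = 1 := Subtype.ext (by simpa using h.symm)
      exact (inv_mul_eq_one.1 this).symm
    · right
      have : A⁻¹ * B = -1 := by
        apply Subtype.ext
        rw [← h]
        ext i j
        fin_cases i <;> fin_cases j <;> simp
      rw [inv_mul_eq_iff_eq_mul] at this
      simpa using this
  · rintro (rfl | rfl)
    · exact ⟨1, by simp, by simp⟩
    · refine ⟨-1, by simp, ?_⟩
      have : A⁻¹ * -A = -1 := by simp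
      rw [this]
      ext i j
      fin_cases i <;> fin_cases j <;> simp

theorem coe_Xm : (Xm : Matrix (Fin 2) (Fin 2) ℤ) = !![-1, 1; -1, 0] := rfl

theorem coe_Ym : (Ym : Matrix (Fin 2) (Fin 2) ℤ) = !![0, -1; 1, 0] := rfl

theorem Xm_mul_Ym : Xm * Ym = ModularGroup.T := by
  apply Subtype.ext
  simp [coe_Xm, coe_Ym, ModularGroup.coe_T]

theorem closure_Xb_Yb : Subgroup.closure {Xb, Yb} = ⊤ := by
  have hX : Xb ∈ Subgroup.closure {Xb, Yb} := Subgroup.subset_closure (by simp)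
  have hY : Yb ∈ Subgroup.closure {Xb, Yb} := Subgroup.subset_closure (by simp)
  rw [eq_top_iff]
  rintro g -
  obtain ⟨A, rfl⟩ := QuotientGroup.mk_surjective g
  have hA : A ∈ Subgroup.closure {ModularGroup.S, ModularGroup.T} := by
    rw [SpecialLinearGroup.SL2Z_generators]; trivial
  suffices Subgroup.closure {ModularGroup.S, ModularGroup.T} ≤
      (Subgroup.closure {Xb, Yb}).comap (QuotientGroup.mk' (Subgroup.center SL2Z)) from this hA
  rw [Subgroup.closure_le]
  rintro _ (rfl | rfl)
  · have : ModularGroup.S = Ym := by ext i j; fin_cases i <;> fin_cases j <;> rfl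
    rw [this]; exact hY
  · rw [← Xm_mul_Ym]; exact mul_mem hX hY

theorem Xb_pow_three : Xb ^ 3 = 1 := by
  have : Xm ^ 3 = 1 := by
    apply Subtype.ext
    simp [pow_succ, coe_Xm, Matrix.one_fin_two]
  rw [Xb, ← QuotientGroup.mk_pow, this]; rfl

theorem Yb_mul_Yb : Yb * Yb = 1 := by
  have : Ym * Ym = -1 := by
    apply Subtype.ext
    simp [coe_Ym, Matrix.one_fin_two]
  rw [Yb, ← QuotientGroup.mk_mul, this]
  exact (PSL2Z.mk_eq_mk_iff (-1) 1).2 (.inr (neg_neg 1).symm)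

/-- The centralizer of the parabolic element `XY` consists of its powers. -/
theorem exists_zpow_of_commute {g : PSL2Z} (h : Commute g (Xb * Yb)) :
    ∃ n : ℤ, g = (Xb * Yb) ^ n := by
  obtain ⟨A, rfl⟩ := QuotientGroup.mk_surjective g
  have hT : Xb * Yb = QuotientGroup.mk ModularGroup.T := by rw [← Xm_mul_Ym]; rfl
  rw [hT] at h ⊢
  have hdet := A.det_coe
  rw [Matrix.det_fin_two] at hdet
  have h' := (PSL2Z.mk_eq_mk_iff _ _).1 h.eq
  have hc : ∀ B C : SL2Z, B = C → ∀ i j, B i j = C i j := by rintro B _ rfl _ _; rfl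
  rcases h' with h' | h'
  · have e00 := hc _ _ h' 0 0
    have e01 := hc _ _ h' 0 1
    simp [ModularGroup.coe_T, Matrix.mul_apply, Fin.sum_univ_two] at e00 e01
    have e : A 0 0 = A 1 1 := by linarith
    rw [e00, e] at hdet
    have : A 1 1 = 1 ∨ A 1 1 = -1 := by
      apply Int.eq_one_or_neg_one_of_mul_eq_one (u := A 1 1) (v := A 1 1); linarith
    rcases this with h1 | h1
    · refine ⟨A 0 1, ?_⟩
      rw [← QuotientGroup.mk_zpow, PSL2Z.mk_eq_mk_iff]
      left
      ext i j
      rw [ModularGroup.coe_T_zpow]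
      fin_cases i <;> fin_cases j <;> simp [*]
    · refine ⟨-A 0 1, ?_⟩
      rw [← QuotientGroup.mk_zpow, PSL2Z.mk_eq_mk_iff]
      right
      ext i j
      rw [ModularGroup.coe_T_zpow]
      fin_cases i <;> fin_cases j <;> simp [*]
  · have e10 := hc _ _ h' 1 0
    have e00 := hc _ _ h' 0 0
    simp [ModularGroup.coe_T, Matrix.mul_apply, Fin.sum_univ_two] at e00 e10
    have e : A 1 0 = 0 := by linarith
    have e' : A 0 0 = 0 := by linarith
    simp [e, e'] at hdet

/-- Products of `YX` and `YX⁻¹` have, up to sign, positive diagonal and non-positive off-diagonal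
entries. -/
def SignPattern (M : SL2Z) : Prop := 0 < M 0 0 ∧ 0 < M 1 1 ∧ M 0 1 ≤ 0 ∧ M 1 0 ≤ 0

/-! ### The braid group on three strands -/

theorem braid_relation : σ₁ * σ₂ * σ₁ = σ₂ * σ₁ * σ₂ := by
  have h : PresentedGroup.mk braidRel (FreeGroup.of 0 * FreeGroup.of 1 * FreeGroup.of 0 *
      (FreeGroup.of 1 * FreeGroup.of 0 * FreeGroup.of 1)⁻¹) = 1 :=
    PresentedGroup.one_of_mem rfl
  rw [map_mul, map_inv, mul_inv_eq_one] at h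
  exact h

theorem closure_σ : Subgroup.closure {σ₁, σ₂} = ⊤ := by
  rw [← PresentedGroup.closure_range_of braidRel]
  congr 1
  ext g
  simp [σ₁, σ₂, eq_comm]

theorem mem_center_B3_iff {z : B3} : z ∈ Subgroup.center B3 ↔ Commute z σ₁ ∧ Commute z σ₂ := by
  rw [← Subgroup.centralizer_univ, ← Subgroup.coe_top, ← closure_σ, Subgroup.centralizer_closure]
  simp [Subgroup.mem_centralizer_iff, Commute, SemiconjBy, eq_comm]

/-- A preimage `σ₂σ₁` in `B₃` of `X⁻¹`. -/
def pB : B3 := σ₂ * σ₁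

/-- A preimage `σ₂σ₁²` in `B₃` of `Y`. -/
def yB : B3 := σ₂ * σ₁ * σ₁

theorem yB_sq : yB * yB = pB * pB * pB := by
  simp only [yB, pB]
  calc σ₂ * σ₁ * σ₁ * (σ₂ * σ₁ * σ₁) = σ₂ * σ₁ * (σ₁ * σ₂ * σ₁) * σ₁ := by group
    _ = _ := by rw [braid_relation]; group

theorem σ₁_eq : σ₁ = pB⁻¹ * yB := by simp only [yB, pB]; group

theorem σ₂_eq : σ₂ = pB * yB⁻¹ * pB := by simp only [yB, pB]; group

theorem closure_pB_yB : Subgroup.closure {pB, yB} = ⊤ := by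
  have hp : pB ∈ Subgroup.closure {pB, yB} := Subgroup.subset_closure (by simp)
  have hy : yB ∈ Subgroup.closure {pB, yB} := Subgroup.subset_closure (by simp)
  rw [eq_top_iff, ← closure_σ, Subgroup.closure_le]
  rintro _ (rfl | rfl)
  · rw [σ₁_eq]; exact mul_mem (inv_mem hp) hy
  · rw [σ₂_eq]; exact mul_mem (mul_mem hp (inv_mem hy)) hp

theorem yB_sq_mem_center : yB * yB ∈ Subgroup.center B3 := by
  have hy : Commute (yB * yB) yB := (Commute.refl yB).mul_left (Commute.refl yB)
  have hp : Commute (yB * yB) pB := by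
    rw [yB_sq]; exact ((Commute.refl pB).mul_left (Commute.refl pB)).mul_left (Commute.refl pB)
  rw [mem_center_B3_iff, σ₁_eq, σ₂_eq]
  exact ⟨hp.inv_right.mul_right hy, (hp.mul_right hy.inv_right).mul_right hp⟩

theorem zpowers_yB_sq_le_center : Subgroup.zpowers (yB * yB) ≤ Subgroup.center B3 :=
  (Subgroup.zpowers_le).2 yB_sq_mem_center

/-- Up to the central element `(σ₂σ₁²)²`, elements of `B₃` have normal forms as in
the free product `PSL(2,ℤ) = ℤ/2 * ℤ/3`. -/
theorem exists_normal_form (u : B3) :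
    ∃ z ∈ Subgroup.zpowers (yB * yB), ∃ q ∈ ({1, pB, pB⁻¹} : Set B3),
      ∃ w ∈ Submonoid.closure {yB * pB, yB * pB⁻¹}, ∃ t ∈ ({1, yB} : Set B3),
        u = z * (q * w * t) := by
  have hz := Subgroup.mem_zpowers (yB * yB)
  set N : Set B3 := {u | ∃ z ∈ Subgroup.zpowers (yB * yB), ∃ q ∈ ({1, pB, pB⁻¹} : Set B3),
      ∃ w ∈ Submonoid.closure {yB * pB, yB * pB⁻¹}, ∃ t ∈ ({1, yB} : Set B3),
        u = z * (q * w * t)} with hN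
  have hcen : ∀ z ∈ Subgroup.zpowers (yB * yB), ∀ v ∈ N, z * v ∈ N := by
    rintro z hz _ ⟨z', hz', q, hq, w, hw, t, ht, rfl⟩
    exact ⟨z * z', mul_mem hz hz', q, hq, w, hw, t, ht, by group⟩
  have hcomm : ∀ z ∈ Subgroup.zpowers (yB * yB), ∀ a v : B3, a * (z * v) = z * (a * v) := by
    intro z hz a v
    rw [← mul_assoc, Subgroup.mem_center_iff.1 (zpowers_yB_sq_le_center hz) a, mul_assoc]
  have hmk : ∀ q ∈ ({1, pB, pB⁻¹} : Set B3),
      ∀ w ∈ Submonoid.closure {yB * pB, yB * pB⁻¹}, ∀ t ∈ ({1, yB} : Set B3), q * w * t ∈ N :=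
    fun q hq w hw t ht => ⟨1, one_mem _, q, hq, w, hw, t, ht, by simp⟩
  have hp : ∀ v ∈ N, pB * v ∈ N := by
    rintro _ ⟨z, hz', q, hq, w, hw, t, ht, rfl⟩
    rw [hcomm z hz']
    refine hcen z hz' _ ?_
    rcases hq with rfl | rfl | rfl
    · simpa [mul_assoc] using hmk pB (by simp) w hw t ht
    · have : pB * (pB * w * t) = (yB * yB) * (pB⁻¹ * w * t) := by rw [yB_sq]; group
      rw [this]
      exact hcen _ hz _ (hmk pB⁻¹ (by simp) w hw t ht)
    · simpa [mul_assoc] using hmk 1 (by simp) w hw t ht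
  have hy : ∀ v ∈ N, yB * v ∈ N := by
    rintro _ ⟨z, hz', q, hq, w, hw, t, ht, rfl⟩
    rw [hcomm z hz']
    refine hcen z hz' _ ?_
    rcases hq with rfl | rfl | rfl
    · induction hw using Submonoid.closure_induction_left with
      | one =>
        rcases ht with rfl | rfl
        · simpa using hmk 1 (by simp) 1 (one_mem _) yB (by simp)
        · simpa using hcen _ hz _ (hmk 1 (by simp) 1 (one_mem _) 1 (by simp))
      | mul_left x hx w hw _ =>
        rcases hx with rfl | rfl
        · simpa [mul_assoc] using hcen _ hz _ (hmk pB (by simp) w hw t ht)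
        · simpa [mul_assoc] using hcen _ hz _ (hmk pB⁻¹ (by simp) w hw t ht)
    · have := hmk 1 (by simp) _
        (mul_mem (Submonoid.subset_closure (by simp : yB * pB ∈ _)) hw) t ht
      simpa [mul_assoc] using this
    · have := hmk 1 (by simp) _
        (mul_mem (Submonoid.subset_closure (by simp : yB * pB⁻¹ ∈ _)) hw) t ht
      simpa [mul_assoc] using this
  have hu : u ∈ Subgroup.closure {pB, yB} := by rw [closure_pB_yB]; trivial
  change u ∈ N
  induction hu using Subgroup.closure_induction_left with
  | one => simpa using hmk 1 (by simp) 1 (one_mem _) 1 (by simp)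
  | mul_left x hx v _ ih =>
    rcases hx with rfl | rfl
    · exact hp v ih
    · exact hy v ih
  | inv_mul_cancel x hx v _ ih =>
    rcases hx with rfl | rfl
    · have : pB⁻¹ * v = (yB * yB)⁻¹ * (pB * (pB * v)) := by rw [yB_sq]; group
      rw [this]
      exact hcen _ (inv_mem hz) _ (hp _ (hp v ih))
    · have : yB⁻¹ * v = (yB * yB)⁻¹ * (yB * v) := by group
      rw [this]
      exact hcen _ (inv_mem hz) _ (hy v ih)

section Projection

variable {φ : B3 →* PSL2Z}

theorem map_pB (h1 : φ σ₁ = Xb * Yb) (h2 : φ σ₂ = Xb ^ 2 * Yb * Xb⁻¹) : φ pB = Xb⁻¹ := by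
  have hX : Xb ^ 2 = Xb⁻¹ := by
    rw [eq_inv_iff_mul_eq_one, ← pow_succ, Xb_pow_three]
  rw [pB, map_mul, h1, h2, hX]
  have : Xb⁻¹ * Yb * Xb⁻¹ * (Xb * Yb) = Xb⁻¹ * (Yb * Yb) := by group
  rw [this, Yb_mul_Yb, mul_one]

theorem map_yB (h1 : φ σ₁ = Xb * Yb) (h2 : φ σ₂ = Xb ^ 2 * Yb * Xb⁻¹) : φ yB = Yb := by
  have : yB = pB * σ₁ := rfl
  rw [this, map_mul, map_pB h1 h2, h1, inv_mul_cancel_left]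

theorem projection_surjective (h1 : φ σ₁ = Xb * Yb) (h2 : φ σ₂ = Xb ^ 2 * Yb * Xb⁻¹) :
    Function.Surjective φ := by
  rw [← MonoidHom.range_eq_top, eq_top_iff, ← closure_Xb_Yb, Subgroup.closure_le]
  rintro _ (rfl | rfl)
  · exact ⟨pB⁻¹, by rw [map_inv, map_pB h1 h2, inv_inv]⟩
  · exact ⟨yB, map_yB h1 h2⟩

/-- Positive words in `yp` and `yp⁻¹` have images with the sign pattern of `SignPattern`, and the
off-diagonal entries vanish only for the empty word. -/
theorem exists_signPattern (h1 : φ σ₁ = Xb * Yb) (h2 : φ σ₂ = Xb ^ 2 * Yb * Xb⁻¹) {w : B3}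
    (hw : w ∈ Submonoid.closure {yB * pB, yB * pB⁻¹}) :
    ∃ M : SL2Z, φ w = QuotientGroup.mk M ∧ SignPattern M ∧ (w = 1 ∨ M 0 1 + M 1 0 < 0) := by
  induction hw using Submonoid.closure_induction_left with
  | one => exact ⟨1, by rw [map_one]; rfl, by simp [SignPattern], .inl rfl⟩
  | mul_left x hx w _ ih =>
    obtain ⟨M, hM, ⟨h00, h11, h01, h10⟩, -⟩ := ih
    rcases hx with rfl | rfl
    · refine ⟨-(Ym * Xm⁻¹ * M), ?_, ?_⟩
      · rw [map_mul, map_mul, map_yB h1 h2, map_pB h1 h2, hM]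
        exact (PSL2Z.mk_eq_mk_iff (Ym * Xm⁻¹ * M) _).2 (.inr rfl)
      · simp [SignPattern, coe_Xm, coe_Ym, Matrix.adjugate_fin_two, Matrix.vecMul,
          dotProduct, Fin.sum_univ_two]
        omega
    · refine ⟨Ym * Xm * M, ?_, ?_⟩
      · rw [map_mul, map_mul, map_inv, map_yB h1 h2, map_pB h1 h2, hM, inv_inv]
        rfl
      · simp [SignPattern, coe_Xm, coe_Ym, Matrix.mul_apply, Fin.sum_univ_two]
        omega

theorem ker_le_center (h1 : φ σ₁ = Xb * Yb) (h2 : φ σ₂ = Xb ^ 2 * Yb * Xb⁻¹) :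
    φ.ker ≤ Subgroup.center B3 := by
  intro u hu
  obtain ⟨z, hz, q, hq, w, hw, t, ht, rfl⟩ := exists_normal_form u
  obtain ⟨M, hwM, hM, hM'⟩ := exists_signPattern h1 h2 hw
  have hφz : φ z = 1 := by
    obtain ⟨k, rfl⟩ := Subgroup.mem_zpowers_iff.1 hz
    rw [map_zpow, map_mul, map_yB h1 h2, Yb_mul_Yb, one_zpow]
  rw [MonoidHom.mem_ker, map_mul, hφz, one_mul, map_mul, map_mul] at hu
  have hw' : φ w = (φ q)⁻¹ * (φ t)⁻¹ := by
    rw [eq_mul_inv_iff_mul_eq, ← mul_right_inj (φ q), ← mul_assoc, hu, mul_inv_cancel]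
  have hcase : ∀ N : SL2Z, φ w = QuotientGroup.mk N → N = M ∨ M = -N := fun N hN => by
    rw [hwM, PSL2Z.mk_eq_mk_iff] at hN
    exact hN.imp_right fun h => by rw [h, neg_neg]
  have absurd_case : ∀ N : SL2Z, φ w = QuotientGroup.mk N → ¬ SignPattern N →
      ¬ SignPattern (-N) → False := fun N hN h h' => by
    rcases hcase N hN with rfl | rfl
    · exact h hM
    · exact h' hM
  rcases hq with rfl | rfl | rfl <;> rcases ht with rfl | rfl <;>
    simp only [map_one, map_inv, map_pB h1 h2, map_yB h1 h2, inv_inv, inv_one, one_mul,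
      mul_one] at hw'
  · have : w = 1 := by
      refine hM'.resolve_right fun h => ?_
      rcases hcase 1 hw' with rfl | rfl <;> simp at h
    simpa [this] using zpowers_yB_sq_le_center hz
  · exact (absurd_case Ym⁻¹ hw' (by simp [SignPattern, coe_Ym, Matrix.adjugate_fin_two])
      (by simp [SignPattern, coe_Ym, Matrix.adjugate_fin_two])).elim
  · exact (absurd_case Xm hw' (by simp [SignPattern, coe_Xm]) (by simp [SignPattern, coe_Xm])).elim
  · refine (absurd_case (Xm * Ym⁻¹) hw' ?_ ?_).elim <;>
      simp [SignPattern, coe_Xm, coe_Ym, Matrix.adjugate_fin_two]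
  · refine (absurd_case Xm⁻¹ hw' ?_ ?_).elim <;>
      simp [SignPattern, coe_Xm, Matrix.adjugate_fin_two]
  · refine (absurd_case (Xm⁻¹ * Ym⁻¹) hw' ?_ ?_).elim <;>
      simp [SignPattern, coe_Xm, coe_Ym, Matrix.adjugate_fin_two]

theorem injOn_conjugates_σ₁ (h1 : φ σ₁ = Xb * Yb) (h2 : φ σ₂ = Xb ^ 2 * Yb * Xb⁻¹) :
    Set.InjOn φ {m | IsConj σ₁ m} := by
  intro a ha b hb hab
  obtain ⟨g, rfl⟩ := isConj_iff.1 ha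
  obtain ⟨h, rfl⟩ := isConj_iff.1 hb
  have hc : Commute (φ (h⁻¹ * g)) (Xb * Yb) := by
    rw [← h1, commute_iff_eq, map_mul, map_inv]
    simp only [map_mul, map_inv] at hab
    rw [mul_inv_eq_iff_eq_mul] at hab
    rw [mul_assoc, hab]
    group
  obtain ⟨n, hn⟩ := exists_zpow_of_commute hc
  have hk : h⁻¹ * g * σ₁ ^ (-n) ∈ Subgroup.center B3 := by
    apply ker_le_center h1 h2
    rw [MonoidHom.mem_ker, map_mul, hn, map_zpow, h1, ← zpow_add, add_neg_cancel, zpow_zero]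
  have hs : Commute (h⁻¹ * g) σ₁ := by
    have e : h⁻¹ * g = h⁻¹ * g * σ₁ ^ (-n) * σ₁ ^ n := by group
    rw [e]
    exact (Commute.symm (Subgroup.mem_center_iff.1 hk σ₁)).mul_left (Commute.zpow_self σ₁ n)
  have := hs.eq
  calc g * σ₁ * g⁻¹ = h * (h⁻¹ * g * σ₁) * g⁻¹ := by group
    _ = h * σ₁ * h⁻¹ := by rw [this]; group

end Projection

theorem stmt_8 (φ : B3 →* PSL2Z)
    (h1 : φ σ₁ = Xb * Yb) (h2 : φ σ₂ = Xb ^ 2 * Yb * Xb⁻¹) :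
    -- the projection takes simple factorizations to simple factorizations
    (∀ l : List B3, SimpleB3 l → SimplePSL (l.map φ)) ∧
    -- it preserves and reflects strong and weak Hurwitz equivalence
    (∀ l₁ l₂ : List B3, SimpleB3 l₁ → SimpleB3 l₂ →
      (StrongEq l₁ l₂ ↔ StrongEq (l₁.map φ) (l₂.map φ)) ∧
      (WeakEq l₁ l₂ ↔ WeakEq (l₁.map φ) (l₂.map φ))) ∧
    -- and it is a bijection between simple factorizations of each length `r`
    (∀ r : ℕ, ∀ w : List PSL2Z, w.length = r → SimplePSL w →
      ∃! l : List B3, l.length = r ∧ SimpleB3 l ∧ l.map φ = w) := by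
  have hinj := injOn_conjugates_σ₁ h1 h2
  have hsurj := projection_surjective h1 h2
  refine ⟨?_, fun l₁ l₂ hl₁ hl₂ =>
    ⟨strongEq_map_iff hinj hl₁ hl₂, weakEq_map_iff hinj hsurj hl₁ hl₂⟩, ?_⟩
  · intro l hl m hm
    obtain ⟨n, hn, rfl⟩ := List.mem_map.1 hm
    rw [← h1]
    exact φ.map_isConj (hl n hn)
  · rintro r w rfl hw
    obtain ⟨l, hl, rfl⟩ := exists_isConj_lift (φ := φ) (s := σ₁) hsurj (by rw [h1]; exact hw)
    refine ⟨l, ⟨by simp, hl, rfl⟩, ?_⟩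
    rintro l' ⟨-, hl', h⟩
    exact List.map_injOn_forall hinj hl' hl h
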